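/- arXiv:1903.06309 — 2 statements merged into one kernel-verified Lean document; each statement's English description precedes it below -/
import Mathlib

section
/- For every σ > 0, the function σ ↦ V(σ) is differentiable at σ, with derivative V′(σ) = ∫_ℝ ((x² − σ²)/σ³) · (1/(σ√(2π))) · exp(−x²/(2σ²)) · Q(x) dx. -/
open Real MeasureTheory

/-- Gaussian density with mean 0 and standard deviation `σ`. -/
noncomputable def gauss (σ x : ℝ) : ℝ :=
  (1 / (σ * Real.sqrt (2 * Real.pi))) * Real.exp (-x ^ 2 / (2 * σ ^ 2))

/-- The value function determined by the Q-function `Q`. -/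
noncomputable def V (Q : ℝ → ℝ) (σ : ℝ) : ℝ := ∫ x, gauss σ x * Q x

/-- The derivative of the Gaussian density with respect to its standard deviation. -/
theorem hasDerivAt_gauss {s : ℝ} (hs : s ≠ 0) (x : ℝ) :
    HasDerivAt (fun t => gauss t x) ((x ^ 2 - s ^ 2) / s ^ 3 * gauss s x) s := by
  have hc : Real.sqrt (2 * Real.pi) ≠ 0 := by positivity
  have h₁ : HasDerivAt (fun t : ℝ => 1 / (t * Real.sqrt (2 * Real.pi))) _ s :=
    (hasDerivAt_const s (1 : ℝ)).fun_div ((hasDerivAt_id' s).mul_const _) (mul_ne_zero hs hc)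
  have h₂ : HasDerivAt (fun t : ℝ => -x ^ 2 / (2 * t ^ 2)) _ s :=
    (hasDerivAt_const s (-x ^ 2)).fun_div ((hasDerivAt_pow 2 s).const_mul 2) (by positivity)
  refine (h₁.fun_mul h₂.exp).congr_deriv ?_
  unfold gauss
  field_simp
  ring

theorem continuous_gauss (s : ℝ) : Continuous (gauss s) := by
  unfold gauss
  fun_prop

/-- The derivative of the Gaussian density in the standard deviation is bounded on compact sets
on which the standard deviation does not vanish. -/
theorem exists_bound_deriv_gauss {S K : Set ℝ} (hS : IsCompact S) (hS₀ : ∀ s ∈ S, s ≠ 0)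
    (hK : IsCompact K) :
    ∃ M : ℝ, ∀ s ∈ S, ∀ x ∈ K, ‖(x ^ 2 - s ^ 2) / s ^ 3 * gauss s x‖ ≤ M := by
  have hcont : ContinuousOn
      (fun p : ℝ × ℝ => (p.2 ^ 2 - p.1 ^ 2) / p.1 ^ 3 * gauss p.1 p.2) (S ×ˢ K) := by
    have hc : Real.sqrt (2 * Real.pi) ≠ 0 := by positivity
    unfold gauss
    intro p hp
    have hp₀ : p.1 ≠ 0 := hS₀ p.1 hp.1
    apply ContinuousAt.continuousWithinAt
    fun_prop (disch := positivity)
  obtain ⟨M, hM⟩ := (hS.prod hK).exists_bound_of_continuousOn hcont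
  exact ⟨M, fun s hs x hx => hM (s, x) ⟨hs, hx⟩⟩

/-- The product of a continuous function with a bounded measurable function vanishing outside
a compact set is integrable. -/
theorem integrable_continuous_mul {f Q : ℝ → ℝ} {K : Set ℝ} (hf : Continuous f)
    (hK : IsCompact K) (hQ : Measurable Q) {C : ℝ} (hC : ∀ x, ‖Q x‖ ≤ C)
    (hQK : ∀ x, x ∉ K → Q x = 0) : Integrable fun x => f x * Q x := by
  have h : IntegrableOn (fun x => f x * Q x) K :=
    (hf.continuousOn.integrableOn_compact hK).mul_bdd (c := C) hQ.aestronglyMeasurable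
      (Filter.Eventually.of_forall hC)
  exact h.integrable_of_forall_notMem_eq_zero fun x hx => by rw [hQK x hx, mul_zero]

theorem hasDerivAt_V (d w : ℝ) (hd : 0 < d) (hw : 0 < w) (Q : ℝ → ℝ)
    (hQmeas : Measurable Q) (hQbdd : ∃ C : ℝ, ∀ x, Q x ≤ C)
    (hQnonneg : ∀ x, 0 ≤ Q x)
    (hQsupp : ∀ x, x ∉ Set.Icc d (d + w) → Q x = 0)
    (hQne : ¬ (Q =ᵐ[volume] 0)) (σ : ℝ) (hσ : 0 < σ) :
    HasDerivAt (fun s => V Q s)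
      (∫ x, ((x ^ 2 - σ ^ 2) / σ ^ 3) * gauss σ x * Q x) σ := by
  obtain ⟨C, hC⟩ := hQbdd
  have hC' : ∀ x, ‖Q x‖ ≤ C := fun x => by
    rw [Real.norm_of_nonneg (hQnonneg x)]
    exact hC x
  have hpos : ∀ s ∈ Set.Icc (σ / 2) (2 * σ), s ≠ 0 := fun s hs =>
    ne_of_gt (by linarith [hs.1])
  obtain ⟨M, hM⟩ := exists_bound_deriv_gauss isCompact_Icc hpos
    (isCompact_Icc (a := d) (b := d + w))
  have hint {f : ℝ → ℝ} (hf : Continuous f) : Integrable fun x => f x * Q x :=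
    integrable_continuous_mul hf isCompact_Icc hQmeas hC' hQsupp
  have hderiv_cont : Continuous fun x : ℝ => (x ^ 2 - σ ^ 2) / σ ^ 3 * gauss σ x :=
    (by fun_prop : Continuous fun x : ℝ => (x ^ 2 - σ ^ 2) / σ ^ 3).mul (continuous_gauss σ)
  refine (hasDerivAt_integral_of_dominated_loc_of_deriv_le
    (F := fun s x => gauss s x * Q x)
    (F' := fun s x => (x ^ 2 - s ^ 2) / s ^ 3 * gauss s x * Q x)
    (bound := fun x => M * Q x)
    (Icc_mem_nhds (by linarith : σ / 2 < σ) (by linarith : σ < 2 * σ))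
    (Filter.Eventually.of_forall fun s => (hint (continuous_gauss s)).aestronglyMeasurable)
    (hint (continuous_gauss σ)) (hint hderiv_cont).aestronglyMeasurable
    (Filter.Eventually.of_forall fun x s hs => ?_) (hint continuous_const)
    (Filter.Eventually.of_forall fun x s hs =>
      (hasDerivAt_gauss (hpos s hs) x).mul_const (Q x))).2
  by_cases hx : x ∈ Set.Icc d (d + w)
  · rw [norm_mul, Real.norm_of_nonneg (hQnonneg x)]
    exact mul_le_mul_of_nonneg_right (hM s hs x hx) (hQnonneg x)
  · simp [hQsupp x hx]
end

section
/- The function V is strictly decreasing on the interval [d + w, ∞): for all d + w ≤ σ₁ < σ₂, V(σ₂) < V(σ₁). -/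
open Real MeasureTheory

/-- At a fixed point `x`, the Gaussian density strictly decreases in `σ` once `|x| ≤ σ`. -/
theorem gauss_lt_gauss {σ₁ σ₂ x : ℝ} (h₁ : 0 < σ₁) (h₁₂ : σ₁ < σ₂) (hx : x ^ 2 ≤ σ₁ ^ 2) :
    gauss σ₂ x < gauss σ₁ x := by
  have h₂ : 0 < σ₂ := h₁.trans h₁₂
  set s := σ₁ / σ₂ with hs
  have hs0 : 0 < s := div_pos h₁ h₂
  have hs1 : s < 1 := (div_lt_one h₂).2 h₁₂
  have hs2 : s ^ 2 < 1 := by nlinarith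
  have hlt : s < exp ((s ^ 2 - 1) / 2) := by
    refine lt_of_pow_lt_pow_left₀ 2 (exp_pos _).le ?_
    have h := add_one_lt_exp (x := s ^ 2 - 1) (by linarith)
    rw [← Real.exp_nat_mul]
    calc s ^ 2 < exp (s ^ 2 - 1) := by linarith
      _ = _ := by congr 1; push_cast; ring
  have hle : (s ^ 2 - 1) / 2 ≤ -x ^ 2 / (2 * σ₁ ^ 2) - -x ^ 2 / (2 * σ₂ ^ 2) := by
    have hu : x ^ 2 / σ₁ ^ 2 ≤ 1 := (div_le_one (by positivity)).2 hx
    have he : -x ^ 2 / (2 * σ₁ ^ 2) - -x ^ 2 / (2 * σ₂ ^ 2)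
        = x ^ 2 / σ₁ ^ 2 * (s ^ 2 - 1) / 2 := by
      rw [hs]; field_simp; ring
    rw [he]
    nlinarith
  have hmain : s * exp (-x ^ 2 / (2 * σ₂ ^ 2)) < exp (-x ^ 2 / (2 * σ₁ ^ 2)) := by
    have h := hlt.trans_le (exp_le_exp.2 hle)
    rwa [exp_sub, lt_div_iff₀ (exp_pos _)] at h
  have hc : 0 < √(2 * π) := by positivity
  have hE : gauss σ₂ x = 1 / (σ₁ * √(2 * π)) * (s * exp (-x ^ 2 / (2 * σ₂ ^ 2))) := by
    rw [gauss, hs]; field_simp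
  rw [hE, gauss]
  exact mul_lt_mul_of_pos_left hmain (by positivity)

theorem integrable_gauss_mul {σ : ℝ} (hσ : 0 < σ) {Q : ℝ → ℝ} (hQ : Integrable Q) :
    Integrable fun x => gauss σ x * Q x := by
  refine hQ.bdd_mul (c := 1 / (σ * √(2 * π))) ?_ (.of_forall fun x => ?_)
  · unfold gauss
    exact Continuous.aestronglyMeasurable (by fun_prop)
  · have hc : 0 < 1 / (σ * √(2 * π)) := by positivity
    rw [gauss, norm_of_nonneg (by positivity)]
    refine mul_le_of_le_one_right hc.le (exp_le_one_iff.2 ?_)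
    exact div_nonpos_of_nonpos_of_nonneg (by nlinarith [sq_nonneg x]) (by positivity)

theorem V_strictAnti_on_Ici (d w : ℝ) (hd : 0 < d) (hw : 0 < w) (Q : ℝ → ℝ)
    (hQmeas : Measurable Q) (hQbdd : ∃ C : ℝ, ∀ x, Q x ≤ C)
    (hQnonneg : ∀ x, 0 ≤ Q x)
    (hQsupp : ∀ x, x ∉ Set.Icc d (d + w) → Q x = 0)
    (hQne : ¬ (Q =ᵐ[volume] 0)) :
    ∀ σ₁ σ₂ : ℝ, d + w ≤ σ₁ → σ₁ < σ₂ → V Q σ₂ < V Q σ₁ := by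
  intro σ₁ σ₂ h₁ h₁₂
  obtain ⟨C, hC⟩ := hQbdd
  have hσ₁ : 0 < σ₁ := by linarith
  have hσ₂ : 0 < σ₂ := by linarith
  have hQ : Integrable Q := by
    refine (integrableOn_iff_integrable_of_support_subset (s := Set.Icc d (d + w)) ?_).1 ?_
    · intro x hx
      by_contra h
      exact hx (hQsupp x h)
    · refine Measure.integrableOn_of_bounded (M := C) measure_Icc_lt_top.ne
        hQmeas.aestronglyMeasurable (.of_forall fun x => ?_)
      rw [norm_of_nonneg (hQnonneg x)]
      exact hC x
  have hi₁ := integrable_gauss_mul hσ₁ hQ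
  have hi₂ := integrable_gauss_mul hσ₂ hQ
  have hpos : ∀ x, Q x ≠ 0 → gauss σ₂ x * Q x < gauss σ₁ x * Q x := by
    intro x hx
    have hmem : x ∈ Set.Icc d (d + w) := by
      by_contra h
      exact hx (hQsupp x h)
    exact mul_lt_mul_of_pos_right
      (gauss_lt_gauss hσ₁ h₁₂ (by nlinarith [hmem.1, hmem.2]))
      ((hQnonneg x).lt_of_ne' hx)
  have hle : ∀ x, gauss σ₂ x * Q x ≤ gauss σ₁ x * Q x := by
    intro x
    by_cases hx : Q x = 0
    · simp [hx]
    · exact (hpos x hx).le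
  refine lt_of_le_of_ne (integral_mono hi₂ hi₁ hle) fun heq => hQne ?_
  have hae := (integral_eq_iff_of_ae_le hi₂ hi₁ (.of_forall hle)).1 heq
  filter_upwards [hae] with x hx
  by_contra h
  exact (hpos x h).ne hx
end
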